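/- Let G be an abelian group, A a finite nonempty subset of G, and D a nonempty subset of A − A. Put σ := Σ_{s∈D} |A − A_s|. Then there exist an integer l ≥ |D|²/(4σ) and distinct elements s₁, …, s_l ∈ D such that the sets A_{s₁}, …, A_{s_l} are pairwise disjoint. In particular, if |A² − Δ₂(A)| ≤ |A − A|²/M for a real M ≥ 1, then taking D = A − A one can find at least M/4 pairwise disjoint sets among the A_s, s ∈ A − A. -/

import Mathlib

open Finset Pointwise

variable {G : Type*} [AddCommGroup G] [DecidableEq G]

/-- `A_s = A ∩ (A - s) = {x ∈ A : x + s ∈ A}`. -/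
def stab (A : Finset G) (s : G) : Finset G := A ∩ A.image (fun a => a - s)

/-- The `n`-fold cartesian power `A^n ⊆ G^n`. -/
def APow (A : Finset G) (n : ℕ) : Finset (Fin n → G) := Fintype.piFinset fun _ => A

/-- The diagonal copy `Δ_n(A) = {(a,…,a) : a ∈ A} ⊆ G^n`. -/
def ADiag (A : Finset G) (n : ℕ) : Finset (Fin n → G) := A.image (fun a _ => a)

theorem mem_stab' (A : Finset G) (s x : G) : x ∈ stab A s ↔ x ∈ A ∧ x + s ∈ A := by
  unfold stab
  simp only [Finset.mem_inter, Finset.mem_image]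
  constructor
  · rintro ⟨h, a, ha, rfl⟩
    exact ⟨h, by simpa using ha⟩
  · rintro ⟨h, h2⟩
    exact ⟨h, x + s, h2, by simp⟩

theorem mem_of_not_disjoint (A : Finset G) (s t : G) (h : ¬ Disjoint (stab A s) (stab A t)) :
    t ∈ A - stab A s := by
  rw [Finset.not_disjoint_iff] at h
  obtain ⟨x, hs, ht⟩ := h
  rw [Finset.mem_sub]
  exact ⟨x + t, ((mem_stab' A t x).1 ht).2, x, hs, by simp⟩

theorem stab_nonempty (A : Finset G) (s : G) (h : s ∈ A - A) : (stab A s).Nonempty := by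
  obtain ⟨a, ha, b, hb, rfl⟩ := Finset.mem_sub.1 h
  exact ⟨b, (mem_stab' _ _ _).2 ⟨hb, by simpa using ha⟩⟩

theorem part_one (A : Finset G) (hA : A.Nonempty)
    (D : Finset G) (hD : D ⊆ A - A) (hDne : D.Nonempty) :
    (0 : ℝ) < ∑ s ∈ D, ((A - stab A s).card : ℝ) ∧
    ∃ T : Finset G, T ⊆ D ∧
        ((D.card : ℝ) ^ 2 / (4 * ∑ s ∈ D, ((A - stab A s).card : ℝ)) ≤ (T.card : ℝ)) ∧
        (∀ s ∈ T, ∀ t ∈ T, s ≠ t → Disjoint (stab A s) (stab A t)) := by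
  have hpos : (0 : ℝ) < ∑ s ∈ D, ((A - stab A s).card : ℝ) := by
    apply Finset.sum_pos _ hDne
    intro s hs
    have := (hA.sub (stab_nonempty A s (hD hs))).card_pos
    exact_mod_cast this
  refine ⟨hpos, ?_⟩
  set σ : ℝ := ∑ s ∈ D, ((A - stab A s).card : ℝ) with hσ
  have hn : (0 : ℝ) < D.card := by exact_mod_cast hDne.card_pos
  set E := D.filter (fun s => ((A - stab A s).card : ℝ) * D.card ≤ 2 * σ) with hE
  set F := D.filter (fun s => ¬ ((A - stab A s).card : ℝ) * D.card ≤ 2 * σ) with hF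
  have hEF : (E.card : ℝ) + F.card = D.card := by
    exact_mod_cast Finset.card_filter_add_card_filter_not (s := D) _
  have hFs : (F.card : ℝ) * (2 * σ) ≤ σ * D.card := by
    calc (F.card : ℝ) * (2 * σ) = ∑ s ∈ F, 2 * σ := by simp
      _ ≤ ∑ s ∈ F, ((A - stab A s).card : ℝ) * D.card := by
        apply Finset.sum_le_sum
        intro s hs
        exact (not_le.1 (Finset.mem_filter.1 hs).2).le
      _ ≤ ∑ s ∈ D, ((A - stab A s).card : ℝ) * D.card := by
        apply Finset.sum_le_sum_of_subset_of_nonneg (Finset.filter_subset _ _)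
        intros
        positivity
      _ = σ * D.card := by rw [hσ, Finset.sum_mul]
  have hE2 : (D.card : ℝ) ≤ 2 * E.card := by
    have : (F.card : ℝ) * 2 ≤ D.card := by
      by_contra hc
      push Not at hc
      nlinarith
    linarith
  let P := E.powerset.filter
    (fun T => ∀ s ∈ T, ∀ t ∈ T, s ≠ t → Disjoint (stab A s) (stab A t))
  have hP : P.Nonempty := ⟨∅, by simp [P]⟩
  obtain ⟨T, hT, hmax⟩ := Finset.exists_max_image P Finset.card hP
  obtain ⟨hTE, hTd⟩ := Finset.mem_filter.1 hT
  rw [Finset.mem_powerset] at hTE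
  refine ⟨T, hTE.trans (Finset.filter_subset _ _), ?_, hTd⟩
  have hcov : E ⊆ T.biUnion (fun t => A - stab A t) := by
    intro u hu
    by_contra hc
    simp only [Finset.mem_biUnion, not_exists, not_and] at hc
    have hdis : ∀ t ∈ T, Disjoint (stab A t) (stab A u) := by
      intro t ht
      by_contra h
      exact hc t ht (mem_of_not_disjoint A t u h)
    have huT : u ∉ T := by
      intro h
      obtain ⟨x, hx⟩ := stab_nonempty A u (hD (Finset.mem_filter.1 hu).1)
      exact Finset.disjoint_left.1 (hdis u h) hx hx
    have hmem : insert u T ∈ P := by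
      refine Finset.mem_filter.2 ⟨Finset.mem_powerset.2 (Finset.insert_subset hu hTE), ?_⟩
      intro s hs t ht hst
      rcases Finset.mem_insert.1 hs with rfl | hs' <;>
        rcases Finset.mem_insert.1 ht with rfl | ht'
      · exact absurd rfl hst
      · exact (hdis t ht').symm
      · exact hdis s hs'
      · exact hTd s hs' t ht' hst
    have := hmax _ hmem
    rw [Finset.card_insert_of_notMem huT] at this
    omega
  have hEc : (E.card : ℝ) ≤ ∑ t ∈ T, ((A - stab A t).card : ℝ) := by
    exact_mod_cast (Finset.card_le_card hcov).trans Finset.card_biUnion_le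
  have hTs : (∑ t ∈ T, ((A - stab A t).card : ℝ)) * D.card ≤ T.card * (2 * σ) := by
    calc (∑ t ∈ T, ((A - stab A t).card : ℝ)) * D.card
        = ∑ t ∈ T, ((A - stab A t).card : ℝ) * D.card := by rw [Finset.sum_mul]
      _ ≤ ∑ t ∈ T, 2 * σ :=
        Finset.sum_le_sum (fun t ht => (Finset.mem_filter.1 (hTE ht)).2)
      _ = T.card * (2 * σ) := by simp
  rw [div_le_iff₀ (by linarith)]
  nlinarith

theorem sum_le_pow (A : Finset G) :
    ∑ s ∈ A - A, (A - stab A s).card ≤ (APow A 2 - ADiag A 2).card := by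
  rw [← Finset.card_sigma]
  apply Finset.card_le_card_of_injOn (fun p => ![p.2, p.1])
  · rintro ⟨s, y⟩ h
    obtain ⟨_, hy⟩ := Finset.mem_sigma.1 h
    obtain ⟨a, ha, b, hb, hab⟩ := Finset.mem_sub.1 hy
    obtain ⟨hb1, hb2⟩ := (mem_stab' _ _ _).1 hb
    refine Finset.mem_sub.2 ⟨![a, b + s], ?_, fun _ => b, ?_, ?_⟩
    · unfold APow
      rw [Fintype.mem_piFinset]
      intro i
      fin_cases i
      · exact ha
      · exact hb2
    · exact Finset.mem_image.2 ⟨b, hb1, rfl⟩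
    · funext i
      fin_cases i
      · exact hab
      · simp
  · rintro ⟨s, y⟩ _ ⟨s', y'⟩ _ h
    have h0 : y = y' := congrFun h 0
    have h1 : s = s' := congrFun h 1
    rw [h0, h1]

theorem stmt_18 (A : Finset G) (hA : A.Nonempty)
    (D : Finset G) (hD : D ⊆ A - A) (hDne : D.Nonempty) :
    (∃ T : Finset G, T ⊆ D ∧
        ((D.card : ℝ) ^ 2 / (4 * ∑ s ∈ D, ((A - stab A s).card : ℝ)) ≤ (T.card : ℝ)) ∧
        (∀ s ∈ T, ∀ t ∈ T, s ≠ t → Disjoint (stab A s) (stab A t))) ∧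
    (∀ M : ℝ, 1 ≤ M →
      ((APow A 2 - ADiag A 2).card : ℝ) ≤ ((A - A).card : ℝ) ^ 2 / M →
      ∃ T : Finset G, T ⊆ A - A ∧ M / 4 ≤ (T.card : ℝ) ∧
        (∀ s ∈ T, ∀ t ∈ T, s ≠ t → Disjoint (stab A s) (stab A t))) := by
  refine ⟨(part_one A hA D hD hDne).2, ?_⟩
  intro M hM hle
  obtain ⟨hpos, T, hT, hc, hd⟩ := part_one A hA (A - A) (Finset.Subset.refl _) (hA.sub hA)
  refine ⟨T, hT, le_trans ?_ hc, hd⟩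
  have h1 : ∑ s ∈ A - A, ((A - stab A s).card : ℝ) ≤ ((APow A 2 - ADiag A 2).card : ℝ) := by
    exact_mod_cast sum_le_pow A
  have h2 := h1.trans hle
  rw [le_div_iff₀ (by linarith)] at h2
  rw [le_div_iff₀ (by linarith)]
  linarith
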